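/- Let n = m² be a perfect square and define f_n : {0,1}^n → {0,1} by f_n = ⋁_{i=0}^{m−1} Parity_m(x_{m·i+1}, x_{m·i+2}, …, x_{m·i+m}), the disjunction of the parities of the m consecutive blocks of m variables. Then size^ndc(f_n) ≤ 2n + o(n); that is, there is a function g(n) = o(n) such that size^ndc(f_n) ≤ 2n + g(n) for all perfect squares n. -/

import Mathlib

/-!
Common definitions: Boolean circuits (with AND/OR/NOT gates of fan-in ≤ 2 and
dummy COPY gates used only for layering), nondeterministic circuits with guess
inputs, width via layerings, nondeterministic branching programs, and
U₂-circuits with their deterministic/nondeterministic circuit complexities.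
-/

/-- A node of a circuit with `n` actual inputs and `m` guess inputs.
Gate nodes refer to their predecessors by (strictly smaller) indices. -/
inductive CNode (n m : ℕ) : Type where
  | actual : Fin n → CNode n m
  | guess  : Fin m → CNode n m
  | const  : Bool → CNode n m
  | gand   : ℕ → ℕ → CNode n m
  | gor    : ℕ → ℕ → CNode n m
  | gnot   : ℕ → CNode n m
  | gcopy  : ℕ → CNode n m
deriving DecidableEq

namespace CNode

/-- The predecessor indices of a node. -/
def preds {n m : ℕ} : CNode n m → List ℕ
  | gand j k => [j, k]
  | gor j k  => [j, k]
  | gnot j   => [j]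
  | gcopy j  => [j]
  | _        => []

/-- Real gates (AND, OR, NOT); these are the gates counted in the size.
COPY gates are dummy gates inserted only to make the circuit layered. -/
def isGate {n m : ℕ} : CNode n m → Bool
  | gand _ _ => true
  | gor _ _  => true
  | gnot _   => true
  | _        => false

/-- Nodes occupying space in a layer (real gates and COPY gates);
these are counted in the width of a layer. -/
def isWide {n m : ℕ} : CNode n m → Bool
  | gand _ _ => true
  | gor _ _  => true
  | gnot _   => true
  | gcopy _  => true
  | _        => false

end CNode

/-- A (nondeterministic) Boolean circuit with `n` actual inputs and `m` guess
inputs: a DAG whose in-degree-0 nodes are labeled by actual inputs, guess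
inputs or constants, whose gates are AND/OR/NOT gates (plus dummy COPY gates),
with a designated output node.  Each guess input labels at most one node. -/
structure Circuit (n m : ℕ) : Type where
  N : ℕ
  node : Fin N → CNode n m
  output : Fin N
  wf : ∀ i : Fin N, ∀ j ∈ (node i).preds, j < (i : ℕ)
  guessOnce : ∀ g : Fin m,
    (Finset.univ.filter (fun i : Fin N => node i = CNode.guess g)).card ≤ 1

namespace Circuit

variable {n m : ℕ}

def nodeAt (c : Circuit n m) (i : ℕ) : CNode n m :=
  if h : i < c.N then c.node ⟨i, h⟩ else CNode.const false

/-- The Boolean value computed at node `i` on actual inputs `x` and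
guess inputs `y`. -/
def evalAux (c : Circuit n m) (x : Fin n → Bool) (y : Fin m → Bool) : ℕ → Bool
  | i =>
    match c.nodeAt i with
    | CNode.actual a => x a
    | CNode.guess g => y g
    | CNode.const b => b
    | CNode.gand j k =>
        (if _h : j < i then c.evalAux x y j else false) &&
        (if _h : k < i then c.evalAux x y k else false)
    | CNode.gor j k =>
        (if _h : j < i then c.evalAux x y j else false) ||
        (if _h : k < i then c.evalAux x y k else false)
    | CNode.gnot j => !(if _h : j < i then c.evalAux x y j else false)
    | CNode.gcopy j => (if _h : j < i then c.evalAux x y j else false)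
termination_by i => i

/-- The output value of the circuit. -/
def eval (c : Circuit n m) (x : Fin n → Bool) (y : Fin m → Bool) : Bool :=
  c.evalAux x y c.output

/-- A nondeterministic circuit computes `f` if for every actual input `x`,
`f x = 1` iff some assignment of the guess inputs makes the circuit output 1.
(For `m = 0` this is the usual notion for deterministic circuits.) -/
def Computes (c : Circuit n m) (f : (Fin n → Bool) → Bool) : Prop :=
  ∀ x : Fin n → Bool, f x = true ↔ ∃ y : Fin m → Bool, c.eval x y = true

/-- The size of a circuit: the number of (non-COPY) gates. -/
def size (c : Circuit n m) : ℕ :=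
  (Finset.univ.filter (fun i : Fin c.N => (c.node i).isGate = true)).card

/-- `ℓ` is a layering of the circuit: every wire goes between adjacent layers. -/
def IsLayering (c : Circuit n m) (ℓ : Fin c.N → ℕ) : Prop :=
  ∀ i : Fin c.N, ∀ j ∈ (c.node i).preds, ∀ hj : j < c.N, ℓ ⟨j, hj⟩ + 1 = ℓ i

/-- The circuit has width at most `w`: there is a layering in which every layer
contains at most `w` gates (real gates and COPY gates). -/
def HasWidth (c : Circuit n m) (w : ℕ) : Prop :=
  ∃ ℓ : Fin c.N → ℕ, c.IsLayering ℓ ∧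
    ∀ t : ℕ,
      (Finset.univ.filter
        (fun i : Fin c.N => ℓ i = t ∧ (c.node i).isWide = true)).card ≤ w

/-- The circuit is read-`k`-times: every actual input labels at most `k` nodes. -/
def ReadK (c : Circuit n m) (k : ℕ) : Prop :=
  ∀ a : Fin n,
    (Finset.univ.filter (fun i : Fin c.N => c.node i = CNode.actual a)).card ≤ k

/-- The maximal number of (non-COPY) gates on a path ending at node `i`. -/
def depthAux (c : Circuit n m) : ℕ → ℕ
  | i =>
    match c.nodeAt i with
    | CNode.actual _ => 0
    | CNode.guess _ => 0
    | CNode.const _ => 0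
    | CNode.gand j k =>
        max (if _h : j < i then c.depthAux j else 0)
            (if _h : k < i then c.depthAux k else 0) + 1
    | CNode.gor j k =>
        max (if _h : j < i then c.depthAux j else 0)
            (if _h : k < i then c.depthAux k else 0) + 1
    | CNode.gnot j => (if _h : j < i then c.depthAux j else 0) + 1
    | CNode.gcopy j => (if _h : j < i then c.depthAux j else 0)
termination_by i => i

/-- The depth of a circuit: the maximal number of gates on a directed path
from an input to the output. -/
def depth (c : Circuit n m) : ℕ := c.depthAux c.output

end Circuit

/-- A nondeterministic branching program on `n` Boolean variables: a DAG whose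
inner nodes are labeled by variables with outgoing edges labeled 0 or 1 (edges
go to strictly larger indices), whose sinks are labeled 0 or 1, with a
designated start node. -/
structure NBP (n : ℕ) : Type where
  N : ℕ
  label : Fin N → Fin n ⊕ Bool
  edges : Fin N → Bool → Finset (Fin N)
  start : Fin N
  wf : ∀ i : Fin N, ∀ b : Bool, ∀ j ∈ edges i b,
        (i : ℕ) < (j : ℕ) ∧ (label i).isLeft

namespace NBP

variable {n : ℕ}

/-- The size of a branching program: the number of its nodes. -/
def size (B : NBP n) : ℕ := B.N

/-- On input `x`, some path from node `i` consistent with `x` reaches a 1-sink. -/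
def AccFrom (B : NBP n) (x : Fin n → Bool) : Fin B.N → Prop
  | i =>
    match B.label i with
    | Sum.inr b => b = true
    | Sum.inl v => ∃ j ∈ B.edges i (x v), ∃ _h : (i : ℕ) < (j : ℕ), B.AccFrom x j
termination_by i => B.N - (i : ℕ)
decreasing_by
  have := j.isLt
  omega

/-- A nondeterministic branching program computes `f` if for every `x`,
`f x = 1` iff at least one path consistent with `x` leads to a 1-sink. -/
def Computes (B : NBP n) (f : (Fin n → Bool) → Bool) : Prop :=
  ∀ x : Fin n → Bool, f x = true ↔ B.AccFrom x B.start

/-- A (syntactic) path in the underlying graph of the branching program. -/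
def IsPath (B : NBP n) : List (Fin B.N) → Prop
  | [] => True
  | [_] => True
  | i :: j :: p => (∃ b : Bool, j ∈ B.edges i b) ∧ B.IsPath (j :: p)

/-- The branching program is syntactic read-`k`-times: every variable appears
at most `k` times on each path. -/
def SyntacticReadK (B : NBP n) (k : ℕ) : Prop :=
  ∀ p : List (Fin B.N), B.IsPath p → ∀ v : Fin n,
    (p.countP fun i => decide (B.label i = Sum.inl v)) ≤ k

end NBP

/-- A node of a `U₂`-circuit.  A gate `gate a b c j k` computes
`((vⱼ ⊕ a) ∧ (v_k ⊕ b)) ⊕ c` from the values `vⱼ, v_k` of its two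
predecessors; these are exactly the Boolean functions in `U₂`
(all two-variable Boolean functions except XOR and its complement). -/
inductive U2Node (n m : ℕ) : Type where
  | actual : Fin n → U2Node n m
  | guess  : Fin m → U2Node n m
  | const  : Bool → U2Node n m
  | gate   : Bool → Bool → Bool → ℕ → ℕ → U2Node n m
deriving DecidableEq

namespace U2Node

def isGate {n m : ℕ} : U2Node n m → Bool
  | gate _ _ _ _ _ => true
  | _ => false

end U2Node

/-- A (nondeterministic) `U₂`-circuit with `n` actual inputs and `m` guess
inputs: every gate has fan-in 2 and is labeled by a function in `U₂`. -/
structure U2Circuit (n m : ℕ) : Type where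
  N : ℕ
  node : Fin N → U2Node n m
  output : Fin N
  wf : ∀ i : Fin N, ∀ a b c j k,
        node i = U2Node.gate a b c j k → j < (i : ℕ) ∧ k < (i : ℕ)

namespace U2Circuit

variable {n m : ℕ}

def nodeAt (c : U2Circuit n m) (i : ℕ) : U2Node n m :=
  if h : i < c.N then c.node ⟨i, h⟩ else U2Node.const false

def evalAux (c : U2Circuit n m) (x : Fin n → Bool) (y : Fin m → Bool) : ℕ → Bool
  | i =>
    match c.nodeAt i with
    | U2Node.actual a => x a
    | U2Node.guess g => y g
    | U2Node.const b => b
    | U2Node.gate a b cc j k =>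
        xor
          ((xor (if _h : j < i then c.evalAux x y j else false) a) &&
           (xor (if _h : k < i then c.evalAux x y k else false) b))
          cc
termination_by i => i

def eval (c : U2Circuit n m) (x : Fin n → Bool) (y : Fin m → Bool) : Bool :=
  c.evalAux x y c.output

/-- A nondeterministic `U₂`-circuit computes `f` if for every actual input `x`,
`f x = 1` iff some assignment of the guess inputs makes the circuit output 1. -/
def Computes (c : U2Circuit n m) (f : (Fin n → Bool) → Bool) : Prop :=
  ∀ x : Fin n → Bool, f x = true ↔ ∃ y : Fin m → Bool, c.eval x y = true

/-- The size of a `U₂`-circuit: the number of its gates. -/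
def size (c : U2Circuit n m) : ℕ :=
  (Finset.univ.filter (fun i : Fin c.N => (c.node i).isGate = true)).card

end U2Circuit

/-- `size^dc f`: the size of the smallest deterministic `U₂`-circuit
computing `f`. -/
noncomputable def sizeDC {n : ℕ} (f : (Fin n → Bool) → Bool) : ℕ :=
  sInf {s : ℕ | ∃ c : U2Circuit n 0, c.Computes f ∧ c.size = s}

/-- `size^ndc f`: the size of the smallest nondeterministic `U₂`-circuit
computing `f`. -/
noncomputable def sizeNDC {n : ℕ} (f : (Fin n → Bool) → Bool) : ℕ :=
  sInf {s : ℕ | ∃ m : ℕ, ∃ c : U2Circuit n m, c.Computes f ∧ c.size = s}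

/-- The parity function: `parityFun n x = 1` iff `Σ xᵢ ≡ 1 (mod 2)`. -/
def parityFun (n : ℕ) : (Fin n → Bool) → Bool :=
  fun x => decide ((∑ i : Fin n, (x i).toNat) % 2 = 1)

theorem blockIdx_lt {m : ℕ} (i j : Fin m) : m * (i : ℕ) + (j : ℕ) < m * m := by
  have hi := i.isLt
  have hj := j.isLt
  nlinarith

/-- The disjunction of the parities of the `m` consecutive blocks of `m`
variables:
`⋁_{i=0}^{m-1} Parity_m (x_{m·i+1}, …, x_{m·i+m})` on `n = m²` variables. -/
def blockParityOr (m : ℕ) : (Fin (m * m) → Bool) → Bool :=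
  fun x => decide (∃ i : Fin m,
    parityFun m (fun j => x ⟨m * (i : ℕ) + (j : ℕ), blockIdx_lt i j⟩) = true)

namespace U2Circuit

variable {n m : ℕ}

theorem evalAux_congr {c d : U2Circuit n m} (x : Fin n → Bool) (y : Fin m → Bool) {N : ℕ}
    (h : ∀ i < N, c.nodeAt i = d.nodeAt i) {i : ℕ} (hi : i < N) :
    c.evalAux x y i = d.evalAux x y i := by
  induction i using Nat.strong_induction_on with
  | _ i ih =>
    rw [evalAux, evalAux, h i hi]
    cases d.nodeAt i with
    | gate a b e j k =>
      have key : ∀ j, (if _h : j < i then c.evalAux x y j else false) =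
          if _h : j < i then d.evalAux x y j else false := by
        intro j
        split
        · exact ih j ‹_› (by omega)
        · rfl
      simp only [key]
    | _ => rfl

/-- Append a gate to a circuit; the new gate becomes the output. -/
def snocGate (c : U2Circuit n m) (a b d : Bool) (j k : Fin c.N) : U2Circuit n m where
  N := c.N + 1
  node := Fin.snoc (α := fun _ => U2Node n m) c.node (U2Node.gate a b d j k)
  output := Fin.last _
  wf := by
    intro i a' b' d' j' k'
    refine Fin.lastCases ?_ (fun i => ?_) i
    · simp only [Fin.snoc_last, Fin.val_last, U2Node.gate.injEq]
      rintro ⟨-, -, -, rfl, rfl⟩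
      exact ⟨j.isLt, k.isLt⟩
    · simp only [Fin.snoc_castSucc, Fin.val_castSucc]
      exact c.wf i a' b' d' j' k'

theorem snocGate_nodeAt_of_lt (c : U2Circuit n m) (a b d : Bool) (j k : Fin c.N) {i : ℕ}
    (hi : i < c.N) : (c.snocGate a b d j k).nodeAt i = c.nodeAt i := by
  have hi' : i < (c.snocGate a b d j k).N := Nat.lt_succ_of_lt hi
  rw [nodeAt, nodeAt, dif_pos hi, dif_pos hi']
  exact Fin.snoc_castSucc (α := fun _ => U2Node n m) _ _ ⟨i, hi⟩

theorem snocGate_nodeAt_last (c : U2Circuit n m) (a b d : Bool) (j k : Fin c.N) :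
    (c.snocGate a b d j k).nodeAt c.N = U2Node.gate a b d j k := by
  have hi' : c.N < (c.snocGate a b d j k).N := Nat.lt_succ_self _
  rw [nodeAt, dif_pos hi']
  exact Fin.snoc_last (α := fun _ => U2Node n m) _ _

theorem snocGate_evalAux_of_lt (c : U2Circuit n m) (a b d : Bool) (j k : Fin c.N)
    (x : Fin n → Bool) (y : Fin m → Bool) {i : ℕ} (hi : i < c.N) :
    (c.snocGate a b d j k).evalAux x y i = c.evalAux x y i :=
  evalAux_congr x y (fun _ => c.snocGate_nodeAt_of_lt a b d j k) hi

theorem snocGate_evalAux_last (c : U2Circuit n m) (a b d : Bool) (j k : Fin c.N)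
    (x : Fin n → Bool) (y : Fin m → Bool) :
    (c.snocGate a b d j k).evalAux x y c.N =
      xor (xor (c.evalAux x y j) a && xor (c.evalAux x y k) b) d := by
  rw [evalAux, snocGate_nodeAt_last]
  simp only [j.isLt, k.isLt, dite_true, snocGate_evalAux_of_lt]

theorem snocGate_size (c : U2Circuit n m) (a b d : Bool) (j k : Fin c.N) :
    (c.snocGate a b d j k).size = c.size + 1 := by
  unfold size
  rw [Finset.card_filter, Finset.card_filter]
  refine (Fin.sum_univ_castSucc (n := c.N) _).trans ?_
  simp only [snocGate, Fin.snoc_castSucc, Fin.snoc_last]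
  rfl

end U2Circuit

/-- A single circuit with at most `s` gates has, for every function in `F` (of the actual inputs
and the guess inputs), a node computing it. -/
def U2Buildable {n m : ℕ} (F : Set ((Fin n → Bool) → (Fin m → Bool) → Bool)) (s : ℕ) : Prop :=
  ∃ c : U2Circuit n m, c.size ≤ s ∧
    ∀ f ∈ F, ∃ i : Fin c.N, ∀ x y, c.evalAux x y i = f x y

namespace U2Buildable

variable {n m s : ℕ} {F G : Set ((Fin n → Bool) → (Fin m → Bool) → Bool)}
  {f g : (Fin n → Bool) → (Fin m → Bool) → Bool}

theorem mono (h : U2Buildable F s) (hG : G ⊆ F) : U2Buildable G s := by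
  obtain ⟨c, hs, hc⟩ := h
  exact ⟨c, hs, fun f hf => hc f (hG hf)⟩

theorem gate (h : U2Buildable F s) (hf : f ∈ F) (hg : g ∈ F) (a b d : Bool) :
    U2Buildable (insert (fun x y => xor (xor (f x y) a && xor (g x y) b) d) F) (s + 1) := by
  obtain ⟨c, hs, hc⟩ := h
  obtain ⟨j, hj⟩ := hc f hf
  obtain ⟨k, hk⟩ := hc g hg
  refine ⟨c.snocGate a b d j k, by rw [U2Circuit.snocGate_size]; omega, ?_⟩
  rintro e (rfl | he)
  · exact ⟨Fin.last _, fun x y =>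
      (c.snocGate_evalAux_last a b d j k x y).trans (by simp only [hj, hk])⟩
  · obtain ⟨i, hi⟩ := hc e he
    refine ⟨i.castSucc, fun x y => ?_⟩
    rw [← hi]
    exact c.snocGate_evalAux_of_lt a b d j k x y i.isLt

theorem and (h : U2Buildable F s) (hf : f ∈ F) (hg : g ∈ F) :
    U2Buildable (insert (fun x y => f x y && g x y) F) (s + 1) := by
  simpa using h.gate hf hg false false false

theorem and_not (h : U2Buildable F s) (hf : f ∈ F) (hg : g ∈ F) :
    U2Buildable (insert (fun x y => f x y && !g x y) F) (s + 1) := by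
  simpa using h.gate hf hg false true false

theorem or (h : U2Buildable F s) (hf : f ∈ F) (hg : g ∈ F) :
    U2Buildable (insert (fun x y => f x y || g x y) F) (s + 1) := by
  simpa using h.gate hf hg true true true

theorem xor (h : U2Buildable F s) (hf : f ∈ F) (hg : g ∈ F) :
    U2Buildable (insert (fun x y => Bool.xor (f x y) (g x y)) F) (s + 3) := by
  have h₁ := h.and_not hf hg
  have h₂ := h₁.and_not (Set.mem_insert_of_mem _ hg) (Set.mem_insert_of_mem _ hf)
  refine (h₂.or (Set.mem_insert_of_mem _ (Set.mem_insert _ _)) (Set.mem_insert _ _)).mono ?_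
  refine Set.insert_subset ?_
    ((Set.subset_insert _ _).trans ((Set.subset_insert _ _).trans (Set.subset_insert _ _)))
  refine Or.inl (funext fun x => funext fun y => ?_)
  cases f x y <;> cases g x y <;> rfl

theorem iterate {A : ℕ → Set ((Fin n → Bool) → (Fin m → Bool) → Bool)} {t k : ℕ}
    (step : ∀ i < k, ∀ s, U2Buildable (A i) s → U2Buildable (A (i + 1)) (s + t))
    (h : U2Buildable (A 0) s) : U2Buildable (A k) (s + k * t) := by
  induction k with
  | zero => simpa using h
  | succ k ih =>
    have := step k (Nat.lt_succ_self k) _ (ih fun i hi => step i (Nat.lt_succ_of_lt hi))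
    rwa [add_assoc, ← Nat.succ_mul] at this

theorem inputs : U2Buildable (n := n) (m := m)
    (insert (fun _ _ => false)
      (Set.range (fun i x _ => x i) ∪ Set.range (fun i _ y => y i))) 0 := by
  let T := Unit ⊕ Fin n ⊕ Fin m
  let e : T ≃ Fin (Fintype.card T) := Fintype.equivFin T
  let v : T → U2Node n m :=
    Sum.elim (fun _ => U2Node.const false) (Sum.elim U2Node.actual U2Node.guess)
  let c : U2Circuit n m :=
    { N := Fintype.card T
      node := fun i => v (e.symm i)
      output := e (Sum.inl ())
      wf := by
        intro i a b d j k h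
        rcases h' : e.symm i with _ | _ | _ <;> simp [v, h'] at h }
  have hnode : ∀ t, c.nodeAt (e t) = v t := by
    intro t
    have ht : (e t : ℕ) < c.N := (e t).isLt
    rw [U2Circuit.nodeAt, dif_pos ht]
    simp [c]
  refine ⟨c, ?_, ?_⟩
  · rw [U2Circuit.size, Nat.le_zero, Finset.card_eq_zero, Finset.filter_eq_empty_iff]
    intro i _
    rcases h' : e.symm i with _ | _ | _ <;> simp [c, v, h', U2Node.isGate]
  · rintro f (rfl | ⟨i, rfl⟩ | ⟨i, rfl⟩)
    · exact ⟨e (Sum.inl ()), fun x y => by rw [U2Circuit.evalAux, hnode]; rfl⟩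
    · exact ⟨e (Sum.inr (Sum.inl i)), fun x y => by rw [U2Circuit.evalAux, hnode]; rfl⟩
    · exact ⟨e (Sum.inr (Sum.inr i)), fun x y => by rw [U2Circuit.evalAux, hnode]; rfl⟩

theorem sizeNDC_le (h : U2Buildable F s) (hf : f ∈ F) {φ : (Fin n → Bool) → Bool}
    (hφ : ∀ x, φ x = true ↔ ∃ y, f x y = true) : sizeNDC φ ≤ s := by
  obtain ⟨c, hs, hc⟩ := h
  obtain ⟨i, hi⟩ := hc f hf
  refine le_trans (Nat.sInf_le ⟨m, { c with output := i }, fun x => ?_, rfl⟩) hs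
  rw [hφ]
  refine exists_congr fun y => ?_
  rw [← hi x y]
  have key : U2Circuit.eval { c with output := i } x y = c.evalAux x y i :=
    U2Circuit.evalAux_congr (c := { c with output := i }) (d := c) x y
      (fun _ _ => rfl) i.isLt
  rw [key]

end U2Buildable

namespace BlockParityOr

variable (m : ℕ)

/-- The `j`-th variable of the `i`-th block. -/
def entry (i j : ℕ) (x : Fin (m * m) → Bool) (_ : Fin m → Bool) : Bool :=
  if h : i < m ∧ j < m then x ⟨m * i + j, blockIdx_lt ⟨i, h.1⟩ ⟨j, h.2⟩⟩ else false

/-- The `i`-th guess input. -/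
def pick (i : ℕ) (_ : Fin (m * m) → Bool) (y : Fin m → Bool) : Bool :=
  if h : i < m then y ⟨i, h⟩ else false

/-- Some guess input before the `i`-th is true. -/
def anyBefore : ℕ → (Fin (m * m) → Bool) → (Fin m → Bool) → Bool
  | 0 => fun _ _ => false
  | i + 1 => fun x y => anyBefore i x y || pick m i x y

/-- The `i`-th guess input is the first true one. -/
def first (i : ℕ) (x : Fin (m * m) → Bool) (y : Fin m → Bool) : Bool :=
  pick m i x y && !anyBefore m i x y

/-- The `j`-th variable of the selected block, if that block is among the first `k`. -/
def column (j : ℕ) : ℕ → (Fin (m * m) → Bool) → (Fin m → Bool) → Bool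
  | 0 => fun _ _ => false
  | k + 1 => fun x y => column j k x y || (first m k x y && entry m k j x y)

/-- The parity of the first `j` variables of the selected block. -/
def parityUpTo : ℕ → (Fin (m * m) → Bool) → (Fin m → Bool) → Bool
  | 0 => fun _ _ => false
  | j + 1 => fun x y => Bool.xor (parityUpTo j x y) (column m j m x y)

variable {m} {x : Fin (m * m) → Bool} {y : Fin m → Bool}

theorem pick_eq_false_of_anyBefore_eq_false {i k : ℕ} (h : anyBefore m i x y = false)
    (hk : k < i) : pick m k x y = false := by
  induction i with
  | zero => omega
  | succ i ih =>
    simp only [anyBefore, Bool.or_eq_false_iff] at h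
    rcases Nat.lt_succ_iff_lt_or_eq.1 hk with hk | rfl
    · exact ih h.1 hk
    · exact h.2

theorem anyBefore_eq_false {i : ℕ} (h : ∀ k < i, pick m k x y = false) :
    anyBefore m i x y = false := by
  induction i with
  | zero => rfl
  | succ i ih =>
    simp only [anyBefore, Bool.or_eq_false_iff]
    exact ⟨ih fun k hk => h k (Nat.lt_succ_of_lt hk), h i (Nat.lt_succ_self i)⟩

theorem first_unique {i k : ℕ} (hi : first m i x y = true) (hk : first m k x y = true) :
    i = k := by
  simp only [first, Bool.and_eq_true, Bool.not_eq_true'] at hi hk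
  rcases lt_trichotomy i k with h | h | h
  · simp [pick_eq_false_of_anyBefore_eq_false hk.2 h] at hi
  · exact h
  · simp [pick_eq_false_of_anyBefore_eq_false hi.2 h] at hk

theorem column_eq_true_iff {j k : ℕ} :
    column m j k x y = true ↔ ∃ i < k, first m i x y = true ∧ entry m i j x y = true := by
  induction k with
  | zero => simp [column]
  | succ k ih =>
    simp only [column, Bool.or_eq_true, Bool.and_eq_true, ih, Nat.lt_succ_iff_lt_or_eq]
    constructor
    · rintro (⟨i, hi, h⟩ | h)
      exacts [⟨i, Or.inl hi, h⟩, ⟨k, Or.inr rfl, h⟩]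
    · rintro ⟨i, hi | rfl, h⟩
      exacts [Or.inl ⟨i, hi, h⟩, Or.inr h]

theorem column_eq_entry {i j : ℕ} (hi : i < m) (h : first m i x y = true) :
    column m j m x y = entry m i j x y := by
  rw [Bool.eq_iff_iff, column_eq_true_iff]
  constructor
  · rintro ⟨k, -, hk, he⟩
    rwa [first_unique h hk]
  · exact fun he => ⟨i, hi, h, he⟩

theorem parityUpTo_eq (j : ℕ) :
    parityUpTo m j x y =
      decide ((∑ k ∈ Finset.range j, (column m k m x y).toNat) % 2 = 1) := by
  induction j with
  | zero => rfl
  | succ j ih =>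
    simp only [parityUpTo]
    rw [ih, Finset.sum_range_succ, Bool.eq_iff_iff]
    cases column m j m x y
    · simp
    · simp only [Bool.xor_true, Bool.not_eq_true', decide_eq_false_iff_not, decide_eq_true_eq,
        Bool.toNat_true]
      omega

theorem parityUpTo_of_first {i : Fin m} (h : first m i x y = true) :
    parityUpTo m m x y =
      parityFun m (fun j => x ⟨m * (i : ℕ) + (j : ℕ), blockIdx_lt i j⟩) := by
  rw [parityUpTo_eq, parityFun, Finset.sum_range]
  simp [column_eq_entry i.isLt h, entry]

theorem exists_first_of_parityUpTo (h : parityUpTo m m x y = true) :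
    ∃ i : Fin m, first m i x y = true := by
  by_contra! hne
  have hcol : ∀ j, column m j m x y = false := by
    intro j
    rw [← Bool.not_eq_true, column_eq_true_iff]
    rintro ⟨i, hi, hf, -⟩
    exact hne ⟨i, hi⟩ hf
  simp [parityUpTo_eq, hcol] at h

theorem first_indicator (i : Fin m) : first m i x (fun k => decide (k = i)) = true := by
  simp only [first, Bool.and_eq_true, Bool.not_eq_true']
  refine ⟨by simp [pick], anyBefore_eq_false fun k hk => ?_⟩
  simp [pick, Fin.ext_iff, hk.ne]

theorem blockParityOr_eq_true_iff :
    blockParityOr m x = true ↔ ∃ y, parityUpTo m m x y = true := by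
  simp only [blockParityOr, decide_eq_true_eq]
  constructor
  · rintro ⟨i, hi⟩
    exact ⟨_, (parityUpTo_of_first (first_indicator i)).trans hi⟩
  · rintro ⟨y, hy⟩
    obtain ⟨i, hi⟩ := exists_first_of_parityUpTo hy
    exact ⟨i, (parityUpTo_of_first hi).symm.trans hy⟩

variable (m)

/-- The functions computed by input nodes. -/
def inputFuns : Set ((Fin (m * m) → Bool) → (Fin m → Bool) → Bool) :=
  insert (fun _ _ => false) (Set.range (fun i x _ => x i) ∪ Set.range (fun i _ y => y i))

variable {m}

theorem entry_mem_inputFuns (i j : ℕ) : entry m i j ∈ inputFuns m := by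
  by_cases h : i < m ∧ j < m
  · exact Or.inr (Or.inl ⟨⟨m * i + j, blockIdx_lt ⟨i, h.1⟩ ⟨j, h.2⟩⟩,
      by funext x y; simp [entry, h]⟩)
  · exact Or.inl (by funext x y; simp [entry, h])

theorem pick_mem_inputFuns (i : ℕ) : pick m i ∈ inputFuns m := by
  by_cases h : i < m
  · exact Or.inr (Or.inr ⟨⟨i, h⟩, by funext x y; simp [pick, h]⟩)
  · exact Or.inl (by funext x y; simp [pick, h])

theorem false_mem_inputFuns : (fun _ _ => false) ∈ inputFuns m := Or.inl rfl

theorem buildable_first :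
    U2Buildable (inputFuns m ∪ {f | ∃ i < m, f = first m i}) (m * 2) := by
  have h := U2Buildable.iterate (s := 0) (t := 2) (k := m)
    (A := fun i => inputFuns m ∪ {f | f = anyBefore m i ∨ ∃ k < i, f = first m k})
    (fun i _ s h => by
      have h₁ := h.and_not (f := pick m i) (g := anyBefore m i)
        (Or.inl (pick_mem_inputFuns i)) (Or.inr (Or.inl rfl))
      have h₂ := h₁.or (f := anyBefore m i) (g := pick m i)
        (Or.inr (Or.inr (Or.inl rfl))) (Or.inr (Or.inl (pick_mem_inputFuns i)))
      refine h₂.mono ?_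
      rintro f (hf | rfl | ⟨k, hk, rfl⟩)
      · exact Or.inr (Or.inr (Or.inl hf))
      · exact Or.inl rfl
      · rcases Nat.lt_succ_iff_lt_or_eq.1 hk with hk | rfl
        · exact Or.inr (Or.inr (Or.inr (Or.inr ⟨k, hk, rfl⟩)))
        · exact Or.inr (Or.inl rfl))
    (U2Buildable.inputs.mono (by
      rintro f (hf | rfl | ⟨k, hk, rfl⟩)
      · exact hf
      · exact false_mem_inputFuns
      · omega))
  rw [zero_add] at h
  exact h.mono (Set.union_subset_union_right _ fun f hf => Or.inr hf)

theorem buildable_column_succ {F : Set ((Fin (m * m) → Bool) → (Fin m → Bool) → Bool)} {s : ℕ}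
    (hF : inputFuns m ∪ {f | ∃ i < m, f = first m i} ⊆ F) (h : U2Buildable F s) (j : ℕ) :
    U2Buildable (insert (column m j m) F) (s + m * 2) := by
  refine U2Buildable.iterate (A := fun k => insert (column m j k) F) (fun k hk s h => ?_)
    (h.mono (Set.insert_subset (hF (Or.inl false_mem_inputFuns)) subset_rfl))
  have h₁ := h.and (f := first m k) (g := entry m k j)
    (Or.inr (hF (Or.inr ⟨k, hk, rfl⟩))) (Or.inr (hF (Or.inl (entry_mem_inputFuns k j))))
  have h₂ := h₁.or (f := column m j k) (Or.inr (Or.inl rfl)) (Or.inl rfl)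
  exact h₂.mono (Set.insert_subset (Or.inl rfl)
    fun f hf => Or.inr (Or.inr (Or.inr hf)))

theorem buildable_column :
    U2Buildable (inputFuns m ∪ {f | ∃ j < m, f = column m j m}) (m * 2 + m * (m * 2)) := by
  have h := U2Buildable.iterate (k := m) (t := m * 2)
    (A := fun j => (inputFuns m ∪ {f | ∃ i < m, f = first m i}) ∪
      {f | ∃ k < j, f = column m k m})
    (fun j _ s h => (buildable_column_succ Set.subset_union_left h j).mono (by
      rintro f (hf | ⟨k, hk, rfl⟩)
      · exact Or.inr (Or.inl hf)
      · rcases Nat.lt_succ_iff_lt_or_eq.1 hk with hk | rfl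
        · exact Or.inr (Or.inr ⟨k, hk, rfl⟩)
        · exact Or.inl rfl))
    (buildable_first.mono (by
      rintro f (hf | ⟨k, hk, rfl⟩)
      · exact hf
      · omega))
  exact h.mono (Set.union_subset_union_left _ Set.subset_union_left)

theorem buildable_parityUpTo :
    U2Buildable {parityUpTo m m} (m * 2 + m * (m * 2) + m * 3) := by
  have h := U2Buildable.iterate (k := m) (t := 3)
    (A := fun j => insert (parityUpTo m j) (inputFuns m ∪ {f | ∃ j < m, f = column m j m}))
    (fun j hj s h => (h.xor (f := parityUpTo m j) (g := column m j m)
        (Or.inl rfl) (Or.inr (Or.inr ⟨j, hj, rfl⟩))).mono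
      (Set.insert_subset (Or.inl rfl) fun f hf => Or.inr (Or.inr hf)))
    (buildable_column.mono (Set.insert_subset (Or.inl false_mem_inputFuns) subset_rfl))
  exact h.mono (Set.singleton_subset_iff.2 (Or.inl rfl))

theorem sizeNDC_blockParityOr_le (m : ℕ) : sizeNDC (blockParityOr m) ≤ 2 * (m * m) + 5 * m := by
  have h := (buildable_parityUpTo (m := m)).sizeNDC_le rfl fun x => blockParityOr_eq_true_iff
  exact h.trans_eq (by ring)

end BlockParityOr

/-- For `n = m²`, the disjunction of the parities of the `m`
consecutive blocks of `m` variables has nondeterministic `U₂`-circuit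
complexity at most `2n + o(n)`: there is `g(n) = o(n)` such that
`size^ndc(f_n) ≤ 2n + g(n)` for all perfect squares `n = m²`. -/
theorem sizeNDC_blockParityOr_upper :
    ∃ g : ℕ → ℝ,
      Filter.Tendsto (fun n : ℕ => g n / (n : ℝ)) Filter.atTop (nhds 0) ∧
      ∀ m : ℕ,
        (sizeNDC (blockParityOr m) : ℝ) ≤ 2 * ((m * m : ℕ) : ℝ) + g (m * m) := by
  refine ⟨fun n => 5 * √(n : ℝ), ?_, fun m => ?_⟩
  · have h : Filter.Tendsto (fun n : ℕ => 5 / √(n : ℝ)) Filter.atTop (nhds 0) :=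
      (Real.tendsto_sqrt_atTop.comp tendsto_natCast_atTop_atTop).const_div_atTop 5
    refine h.congr fun n => ?_
    rw [mul_div_assoc, Real.sqrt_div_self, div_eq_mul_inv]
  · have h : √((m * m : ℕ) : ℝ) = m := by
      rw [Nat.cast_mul, Real.sqrt_mul_self m.cast_nonneg]
    simp only [h]
    exact_mod_cast BlockParityOr.sizeNDC_blockParityOr_le m
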